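/- For every feasible CC-MAR instance (G, T), there exists a strategy profile of minimum total cost in which identical terminal pairs are connected by identical paths: that is, a minimum-cost profile P = (P_1, …, P_k) such that whenever (s_i, t_i) = (s_j, t_j) one has P_i = P_j. Moreover, if P is any minimum-cost profile and (s_i, t_i) = (s_j, t_j) with i ≠ j, then the profile obtained from P by replacing P_j with P_i also has minimum total cost. -/

import Mathlib

/-- A mixed graph: a set `E` of undirected edges (non-diagonal `Sym2`s) and
a set `A` of arcs (ordered pairs of distinct vertices). -/
structure MixedGraph (V : Type*) where
  E : Finset (Sym2 V)
  A : Finset (V × V)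
  not_diag : ∀ e ∈ E, ¬ e.IsDiag
  arc_ne : ∀ a ∈ A, a.1 ≠ a.2

variable {V : Type*} [DecidableEq V]

/-- One step of a path: along an undirected edge or along an arc (in its direction). -/
def MixedGraph.Step (G : MixedGraph V) (u v : V) : Prop :=
  s(u, v) ∈ G.E ∨ (u, v) ∈ G.A

instance (G : MixedGraph V) : DecidableRel G.Step :=
  fun _ _ => inferInstanceAs (Decidable (_ ∨ _))

/-- `G.IsPath s t P`: `P` is a path from `s` to `t` in the mixed graph `G`:
a sequence of pairwise distinct vertices starting at `s`, ending at `t`, each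
consecutive step being along an edge or an arc in its direction. -/
def MixedGraph.IsPath (G : MixedGraph V) (s t : V) (P : List V) : Prop :=
  P.Nodup ∧ P.head? = some s ∧ P.getLast? = some t ∧ P.Chain' G.Step

/-- `traverses P u v`: the path `P` moves from `u` directly to `v`. -/
def traverses (P : List V) (u v : V) : Prop := (u, v) ∈ P.zip P.tail

instance (P : List V) (u v : V) : Decidable (traverses P u v) :=
  inferInstanceAs (Decidable ((u, v) ∈ P.zip P.tail))

/-- 0/1 indicator of `traverses P u v`. -/
def dirInd (P : List V) (u v : V) : ℕ := if traverses P u v then 1 else 0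

variable {ι : Type*} [Fintype ι] [DecidableEq ι]

/-- `x_{(u,v)}`: the number of agents whose path traverses the edge `{u,v}` from `u` to `v`. -/
def dirCount (P : ι → List V) (u v : V) : ℕ :=
  (Finset.univ.filter fun i => traverses (P i) u v).card

/-- The total cost `Σ_{e={u,v} ∈ E} w_e · x_{(u,v)} · x_{(v,u)}` of a strategy profile. -/
def MixedGraph.totalCost (G : MixedGraph V) (w : Sym2 V → ℕ) (P : ι → List V) : ℕ :=
  ∑ e ∈ G.E, Sym2.lift ⟨fun u v => w s(u, v) * (dirCount P u v * dirCount P v u),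
    by intro a b; dsimp only; rw [show s(b, a) = s(a, b) from Sym2.eq_swap]; ring⟩ e

/-- The crossing cost of two paths: the sum of `w_e` over edges `e ∈ E` that the
two paths traverse in opposite directions. -/
def MixedGraph.crossCost (G : MixedGraph V) (w : Sym2 V → ℕ) (P Q : List V) : ℕ :=
  ∑ e ∈ G.E, Sym2.lift ⟨fun u v =>
      w s(u, v) * (dirInd P u v * dirInd Q v u + dirInd P v u * dirInd Q u v),
    by intro a b; dsimp only; rw [show s(b, a) = s(a, b) from Sym2.eq_swap]; ring⟩ e

/-- Number of agents other than `i` traversing from `u` to `v`. -/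
def oppCount (P : ι → List V) (i : ι) (u v : V) : ℕ :=
  (Finset.univ.filter fun j => j ≠ i ∧ traverses (P j) u v).card

/-- The individual cost of agent `i`: for each edge `e` traversed by `P i`,
`w_e` times the number of other agents traversing `e` in the opposite direction. -/
def MixedGraph.indivCost (G : MixedGraph V) (w : Sym2 V → ℕ) (P : ι → List V) (i : ι) : ℕ :=
  ∑ e ∈ G.E, Sym2.lift ⟨fun u v =>
      w s(u, v) * (dirInd (P i) u v * oppCount P i v u + dirInd (P i) v u * oppCount P i u v),
    by intro a b; dsimp only; rw [show s(b, a) = s(a, b) from Sym2.eq_swap]; ring⟩ e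

/-- A strategy profile: for each terminal pair `T i = (sᵢ, tᵢ)`, an `sᵢ`–`tᵢ` path. -/
def MixedGraph.IsProfile (G : MixedGraph V) (T : ι → V × V) (P : ι → List V) : Prop :=
  ∀ i, G.IsPath (T i).1 (T i).2 (P i)

/-- A pure Nash equilibrium: no agent can strictly decrease its individual cost
by unilaterally switching to another path between its terminals. -/
def MixedGraph.IsNash (G : MixedGraph V) (w : Sym2 V → ℕ) (T : ι → V × V)
    (P : ι → List V) : Prop :=
  ∀ i (P' : List V), G.IsPath (T i).1 (T i).2 P' →
    G.indivCost w P i ≤ G.indivCost w (Function.update P i P') i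

set_option linter.unusedSectionVars false

/-- A path without repeated vertices does not move along both `(u, v)` and `(v, u)`. -/
theorem List.Nodup.not_traverses_swap {P : List V} (hP : P.Nodup) {u v : V}
    (huv : traverses P u v) : ¬ traverses P v u := by
  intro hvu
  obtain ⟨m, hm, hm'⟩ := List.mem_iff_getElem.1 huv
  obtain ⟨n, hn, hn'⟩ := List.mem_iff_getElem.1 hvu
  simp only [List.length_zip, List.length_tail, lt_inf_iff] at hm hn
  simp only [List.getElem_zip, List.getElem_tail, Prod.mk.injEq] at hm' hn'
  have h₁ := (hP.getElem_inj_iff).1 (hm'.2.trans hn'.1.symm)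
  have h₂ := (hP.getElem_inj_iff).1 (hm'.1.trans hn'.2.symm)
  omega

theorem dirInd_mul_dirInd_swap {P : List V} (hP : P.Nodup) (u v : V) :
    dirInd P u v * dirInd P v u = 0 := by
  by_cases h : traverses P u v
  · simp [dirInd, hP.not_traverses_swap h]
  · simp [dirInd, h]

theorem dirCount_eq_sum (P : ι → List V) (u v : V) :
    dirCount P u v = ∑ l, dirInd (P l) u v := by
  simp [dirCount, dirInd]

theorem dirCount_eq_add_sum {i j : ι} (hij : i ≠ j) (P : ι → List V) (u v : V) :
    dirCount P u v = dirInd (P i) u v + dirInd (P j) u v +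
      ∑ l ∈ (Finset.univ.erase i).erase j, dirInd (P l) u v := by
  rw [dirCount_eq_sum, ← Finset.add_sum_erase _ _ (Finset.mem_univ i),
    ← Finset.add_sum_erase _ _ (Finset.mem_erase.2 ⟨hij.symm, Finset.mem_univ j⟩), add_assoc]

theorem dirCount_update_right {i j : ι} (hij : i ≠ j) (P : ι → List V) (u v : V) :
    dirCount (Function.update P j (P i)) u v = 2 * dirInd (P i) u v +
      ∑ l ∈ (Finset.univ.erase i).erase j, dirInd (P l) u v := by
  rw [dirCount_eq_add_sum hij, Function.update_self, Function.update_of_ne hij, two_mul]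
  congr 1
  refine Finset.sum_congr rfl fun l hl => ?_
  rw [Function.update_of_ne (Finset.ne_of_mem_erase hl)]

/-- Routing agents `i` and `j` both along `P i`, or both along `P j`, is on average no more
expensive than `P` itself. -/
theorem MixedGraph.totalCost_update_add_totalCost_update_le (G : MixedGraph V) (w : Sym2 V → ℕ)
    (P : ι → List V) {i j : ι} (hij : i ≠ j) (hi : (P i).Nodup) (hj : (P j).Nodup) :
    G.totalCost w (Function.update P j (P i)) + G.totalCost w (Function.update P i (P j)) ≤
      2 * G.totalCost w P := by
  simp only [totalCost]
  rw [← Finset.sum_add_distrib, Finset.mul_sum]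
  refine Finset.sum_le_sum fun e _ => ?_
  induction e with | _ u v
  simp only [Sym2.lift_mk]
  rw [← mul_add, mul_left_comm]
  refine Nat.mul_le_mul_left _ ?_
  have hp := dirInd_mul_dirInd_swap hi u v
  have hq := dirInd_mul_dirInd_swap hj u v
  simp only [dirCount_update_right hij, dirCount_update_right hij.symm, dirCount_eq_add_sum hij P]
  rw [Finset.erase_right_comm (a := j) (b := i)]
  generalize ∑ l ∈ (Finset.univ.erase i).erase j, dirInd (P l) u v = r
  generalize ∑ l ∈ (Finset.univ.erase i).erase j, dirInd (P l) v u = r'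
  nlinarith [Nat.zero_le (dirInd (P i) u v * dirInd (P j) v u),
    Nat.zero_le (dirInd (P i) v u * dirInd (P j) u v)]

theorem MixedGraph.IsProfile.update {G : MixedGraph V} {T : ι → V × V} {P : ι → List V}
    (hP : G.IsProfile T P) {i j : ι} (hT : T i = T j) :
    G.IsProfile T (Function.update P j (P i)) := by
  intro l
  rcases eq_or_ne l j with rfl | hl
  · rw [Function.update_self, ← hT]
    exact hP i
  · rw [Function.update_of_ne hl]
    exact hP l

/-- `P` is a strategy profile of minimum total cost. -/
def MixedGraph.IsMinProfile (G : MixedGraph V) (w : Sym2 V → ℕ) (T : ι → V × V)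
    (P : ι → List V) : Prop :=
  G.IsProfile T P ∧ ∀ Q : ι → List V, G.IsProfile T Q → G.totalCost w P ≤ G.totalCost w Q

theorem MixedGraph.IsMinProfile.update {G : MixedGraph V} {w : Sym2 V → ℕ} {T : ι → V × V}
    {P : ι → List V} (hP : G.IsMinProfile w T P) {i j : ι} (hij : i ≠ j) (hT : T i = T j) :
    G.IsMinProfile w T (Function.update P j (P i)) := by
  refine ⟨hP.1.update hT, fun Q hQ => ?_⟩
  have h := G.totalCost_update_add_totalCost_update_le w P hij (hP.1 i).1 (hP.1 j).1
  have hj := hP.2 _ (hP.1.update hT.symm)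
  have hQ' := hP.2 Q hQ
  omega

theorem MixedGraph.exists_isMinProfile (G : MixedGraph V) (w : Sym2 V → ℕ) (T : ι → V × V)
    (hfeas : ∀ i, ∃ Q : List V, G.IsPath (T i).1 (T i).2 Q) :
    ∃ P, G.IsMinProfile w T P := by
  choose Q hQ using hfeas
  obtain ⟨P, hP, hmin⟩ := (measure (G.totalCost w : (ι → List V) → ℕ)).wf.has_min
    {P | G.IsProfile T P} ⟨Q, hQ⟩
  exact ⟨P, hP, fun R hR => not_lt.1 (hmin R hR)⟩

theorem MixedGraph.exists_isMinProfile_eq_of_eq (G : MixedGraph V) (w : Sym2 V → ℕ)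
    (T : ι → V × V) (hfeas : ∀ i, ∃ Q : List V, G.IsPath (T i).1 (T i).2 Q) :
    ∃ P, G.IsMinProfile w T P ∧ ∀ i j, T i = T j → P i = P j := by
  obtain ⟨rep, hrep, hrep'⟩ : ∃ rep : ι → ι, (∀ i, T (rep i) = T i) ∧
      ∀ i j, T i = T j → rep i = rep j :=
    ⟨fun i => Set.rangeSplitting T ⟨T i, i, rfl⟩, fun i => Set.apply_rangeSplitting T _,
      fun i j h => by simp only [h]⟩
  suffices h : ∀ S : Finset ι, ∃ P, G.IsMinProfile w T P ∧ ∀ i ∈ S, P i = P (rep i) by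
    obtain ⟨P, hP, h⟩ := h Finset.univ
    refine ⟨P, hP, fun i j hij => ?_⟩
    rw [h i (Finset.mem_univ i), h j (Finset.mem_univ j), hrep' i j hij]
  intro S
  induction S using Finset.induction_on with
  | empty => simpa using G.exists_isMinProfile w T hfeas
  | insert j S _ ih =>
    obtain ⟨P, hP, h⟩ := ih
    by_cases hj : rep j = j
    · refine ⟨P, hP, fun i hi => ?_⟩
      rcases Finset.mem_insert.1 hi with rfl | hi
      · rw [hj]
      · exact h i hi
    · refine ⟨_, hP.update hj (hrep j), fun i hi => ?_⟩
      have hi' : rep i ≠ j := fun hij => hj (by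
        rw [← hrep' i j (by rw [← hij, hrep]), hij])
      rw [Function.update_of_ne hi']
      rcases eq_or_ne i j with rfl | hne
      · rw [Function.update_self]
      · rw [Function.update_of_ne hne]
        exact h i (Finset.mem_of_mem_insert_of_ne hi hne)

/-- every feasible instance has a minimum-cost strategy profile in which
identical terminal pairs are routed along identical paths; moreover, in any
minimum-cost profile, replacing the path of one copy of a repeated pair by the path
of another copy again yields a (feasible) minimum-cost profile. -/
theorem stmt9 [Fintype V] {k : ℕ} (G : MixedGraph V) (w : Sym2 V → ℕ)
    (hw : ∀ e ∈ G.E, 0 < w e)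
    (T : Fin k → V × V) (hT : ∀ i, (T i).1 ≠ (T i).2)
    (hfeas : ∀ i, ∃ Q : List V, G.IsPath (T i).1 (T i).2 Q) :
    (∃ P : Fin k → List V, G.IsProfile T P ∧
      (∀ Q : Fin k → List V, G.IsProfile T Q → G.totalCost w P ≤ G.totalCost w Q) ∧
      ∀ i j, T i = T j → P i = P j) ∧
    (∀ P : Fin k → List V, G.IsProfile T P →
      (∀ Q : Fin k → List V, G.IsProfile T Q → G.totalCost w P ≤ G.totalCost w Q) →
      ∀ i j, i ≠ j → T i = T j →
        G.IsProfile T (Function.update P j (P i)) ∧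
        ∀ Q : Fin k → List V, G.IsProfile T Q →
          G.totalCost w (Function.update P j (P i)) ≤ G.totalCost w Q) := by
  refine ⟨?_, fun P hP hmin i j hij h => MixedGraph.IsMinProfile.update ⟨hP, hmin⟩ hij h⟩
  obtain ⟨P, hP, h⟩ := G.exists_isMinProfile_eq_of_eq w T hfeas
  exact ⟨P, hP.1, hP.2, h⟩
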